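/- arXiv:2601.13788 — 4 statements merged into one kernel-verified Lean document; each statement's English description precedes it below -/
import Mathlib

section
/- Let n ≥ 1, α ∈ (0,n), A > 0, r > 0 and x₀ ∈ ℝ^n, and let a : ℝ^n → ℝ be measurable with supp a ⊆ B(x₀,r) and |a(y)| ≤ A for a.e. y. Then there exists C = C(n,α) > 0 such that |I_α a(x)| := |∫_{ℝ^n} a(y)|x−y|^{α−n} dy| ≤ C · A · r^α for every x ∈ ℝ^n. -/
open MeasureTheory Metric Filter
open scoped ENNReal NNReal Topology

noncomputable section

abbrev En (n : ℕ) := EuclideanSpace ℝ (Fin n)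

/-- Extended Musielak--Orlicz quasinorm over a set `A`, for `ℝ≥0∞`-valued functions. -/
def eMOnormOn {n : ℕ} (φ : En n → ℝ → ℝ) (A : Set (En n)) (f : En n → ℝ≥0∞) : ℝ≥0∞ :=
  sInf {l : ℝ≥0∞ | 0 < l ∧
    (∫⁻ x in A, (if f x = ⊤ then (⊤ : ℝ≥0∞)
      else ENNReal.ofReal (φ x ((f x).toReal / l.toReal)))) ≤ 1}

/-- Musielak--Orlicz quasinorm `‖f‖_{L^φ(A)}`. -/
def MOnormOn {n : ℕ} (φ : En n → ℝ → ℝ) (A : Set (En n)) (f : En n → ℝ) : ℝ≥0∞ :=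
  eMOnormOn φ A fun x => ENNReal.ofReal |f x|

/-- Musielak--Orlicz quasinorm `‖f‖_{L^φ(ℝ^n)}`. -/
def MOnorm {n : ℕ} (φ : En n → ℝ → ℝ) (f : En n → ℝ) : ℝ≥0∞ :=
  MOnormOn φ Set.univ f

/-- `‖χ_s‖_{L^φ(ℝ^n)}`. -/
def chiNorm {n : ℕ} (φ : En n → ℝ → ℝ) (s : Set (En n)) : ℝ≥0∞ :=
  MOnorm φ (s.indicator fun _ => (1 : ℝ))

/-- `b_B`, the average of `b` over the ball `B(x₀,r)`. -/
def ballAvg {n : ℕ} (b : En n → ℝ) (x₀ : En n) (r : ℝ) : ℝ :=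
  ⨍ x in ball x₀ r, b x

/-- The classical BMO seminorm, as an `ℝ≥0∞`-valued supremum over all balls. -/
def bmoNorm {n : ℕ} (b : En n → ℝ) : ℝ≥0∞ :=
  ⨆ (x₀ : En n) (r : ℝ) (_ : 0 < r),
    ENNReal.ofReal (⨍ x in ball x₀ r, |b x - ballAvg b x₀ r|)

/-- `‖ |·−x₀|^{−n} ‖_{L^φ(B(x₀,r)^c)}`. -/
def kerNorm {n : ℕ} (φ : En n → ℝ → ℝ) (x₀ : En n) (r : ℝ) : ℝ≥0∞ :=
  MOnormOn φ (ball x₀ r)ᶜ fun x => ‖x - x₀‖ ^ (-(n : ℝ))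

/-- The `𝓑𝓜𝓞_φ = 𝓑𝓜𝓞_{φ,∞}` norm. -/
def bmoPhiNorm {n : ℕ} (φ : En n → ℝ → ℝ) (b : En n → ℝ) : ℝ≥0∞ :=
  ⨆ (x₀ : En n) (r : ℝ) (_ : 0 < r),
    (chiNorm φ (ball x₀ r))⁻¹ *
      (∫⁻ x in ball x₀ r, ENNReal.ofReal |b x - ballAvg b x₀ r|) * kerNorm φ x₀ r

/-- The `𝓑𝓜𝓞_{φ,u}` norm, `1 < u < ∞`, with conjugate exponent `u' = u/(u-1)`. -/
def bmoPhiUNorm {n : ℕ} (φ : En n → ℝ → ℝ) (u : ℝ) (b : En n → ℝ) : ℝ≥0∞ :=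
  ⨆ (x₀ : En n) (r : ℝ) (_ : 0 < r),
    ENNReal.ofReal ((volume (ball x₀ r)).toReal ^ (1 / u)) *
      (chiNorm φ (ball x₀ r))⁻¹ *
      (∫⁻ x in ball x₀ r,
          ENNReal.ofReal (|b x - ballAvg b x₀ r| ^ (u / (u - 1)))) ^ (1 - 1 / u) *
      kerNorm φ x₀ r

/-- Musielak--Orlicz function: `φ(x,·)` is an Orlicz function for each `x`, and
`φ(·,t)` is measurable for each `t`. -/
structure IsMOFun {n : ℕ} (φ : En n → ℝ → ℝ) : Prop where
  nonneg : ∀ x t, 0 ≤ φ x t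
  mono : ∀ x, MonotoneOn (φ x) (Set.Ici (0 : ℝ))
  zero : ∀ x, φ x 0 = 0
  pos : ∀ x t, 0 < t → 0 < φ x t
  tends : ∀ x, Tendsto (φ x) atTop atTop
  meas : ∀ t, Measurable fun x => φ x t

/-- Uniformly lower type `p`. -/
def UnifLowerType {n : ℕ} (φ : En n → ℝ → ℝ) (p : ℝ) : Prop :=
  ∃ C > 0, ∀ x t s, 0 ≤ t → s ∈ Set.Ioc (0 : ℝ) 1 → φ x (s * t) ≤ C * s ^ p * φ x t

/-- Uniformly upper type `p`. -/
def UnifUpperType {n : ℕ} (φ : En n → ℝ → ℝ) (p : ℝ) : Prop :=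
  ∃ C > 0, ∀ x t s, 0 ≤ t → 1 ≤ s → φ x (s * t) ≤ C * s ^ p * φ x t

open Classical in
/-- The uniformly Muckenhoupt condition `𝔸_q`, `q ∈ [1,∞)`. -/
def UniformA {n : ℕ} (q : ℝ) (φ : En n → ℝ → ℝ) : Prop :=
  ∃ C > 0, ∀ (x₀ : En n) (r t : ℝ), 0 < r → 0 < t →
    if q = 1 then
      ∀ᵐ y ∂(volume.restrict (ball x₀ r)), (⨍ x in ball x₀ r, φ x t) ≤ C * φ y t
    else
      (⨍ x in ball x₀ r, φ x t) *
        (⨍ x in ball x₀ r, φ x t ^ (-(1 / (q - 1)))) ^ (q - 1) ≤ C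

/-- The uniformly reverse Hölder condition `ℝℍ_r`, `r ∈ (1,∞)`. -/
def UniformRH {n : ℕ} (r : ℝ) (φ : En n → ℝ → ℝ) : Prop :=
  ∃ C > 0, ∀ (x₀ : En n) (ρ t : ℝ), 0 < ρ → 0 < t →
    (⨍ x in ball x₀ ρ, φ x t ^ r) ^ (1 / r) ≤ C * ⨍ x in ball x₀ ρ, φ x t

/-- The uniformly reverse Hölder condition `ℝℍ_∞`. -/
def UniformRHInf {n : ℕ} (φ : En n → ℝ → ℝ) : Prop :=
  ∃ C > 0, ∀ (x₀ : En n) (ρ t : ℝ), 0 < ρ → 0 < t →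
    ∀ᵐ y ∂(volume.restrict (ball x₀ ρ)), φ y t ≤ C * ⨍ x in ball x₀ ρ, φ x t

/-- Growth function: a Musielak--Orlicz function of uniformly lower type `p` for some
`p ∈ (0,1]`, of uniformly upper type `1`, satisfying `𝔸_q` for some `q ∈ [1,∞)`. -/
def IsGrowthFun {n : ℕ} (φ : En n → ℝ → ℝ) : Prop :=
  IsMOFun φ ∧ (∃ p, p ∈ Set.Ioc (0 : ℝ) 1 ∧ UnifLowerType φ p) ∧
    UnifUpperType φ 1 ∧ ∃ q, 1 ≤ q ∧ UniformA q φ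

/-- The Riesz potential `I_α f(x) = ∫ f(y) |x−y|^{α−n} dy`. -/
def rieszPot {n : ℕ} (α : ℝ) (f : En n → ℝ) (x : En n) : ℝ :=
  ∫ y, f y * ‖x - y‖ ^ (α - (n : ℝ))

/-- The commutator `[b, I_α] f(x) = ∫ (b(x)−b(y)) |x−y|^{α−n} f(y) dy`. -/
def commRiesz {n : ℕ} (α : ℝ) (b f : En n → ℝ) (x : En n) : ℝ :=
  ∫ y, (b x - b y) * ‖x - y‖ ^ (α - (n : ℝ)) * f y

/-- The fractional integral with homogeneous kernel `T_{Ω,α}`. -/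
def TOmega {n : ℕ} (Ω : En n → ℝ) (α : ℝ) (f : En n → ℝ) (x : En n) : ℝ :=
  ∫ y, Ω (x - y) * ‖x - y‖ ^ (α - (n : ℝ)) * f y

/-- The commutator `[b, T_{Ω,α}]`. -/
def commTOmega {n : ℕ} (Ω : En n → ℝ) (α : ℝ) (b f : En n → ℝ) (x : En n) : ℝ :=
  ∫ y, (b x - b y) * Ω (x - y) * ‖x - y‖ ^ (α - (n : ℝ)) * f y

/-- The smooth maximal function `M_Φ g(x) = sup_{t>0} |∫ g(y) t^{−n} Φ((x−y)/t) dy|`. -/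
def maxFn {n : ℕ} (Φ : En n → ℝ) (g : En n → ℝ) (x : En n) : ℝ≥0∞ :=
  ⨆ (t : ℝ) (_ : 0 < t),
    ENNReal.ofReal |∫ y, g y * t ^ (-(n : ℝ)) * Φ (t⁻¹ • (x - y))|

/-- The `L^q_φ(B(x₀,ρ))` norm `sup_{t>0} ((1/φ(B,t)) ∫_B |f|^q φ(·,t))^{1/q}`. -/
def LqPhiNorm {n : ℕ} (φ : En n → ℝ → ℝ) (x₀ : En n) (ρ q : ℝ) (f : En n → ℝ) : ℝ≥0∞ :=
  ⨆ (t : ℝ) (_ : 0 < t),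
    ((∫⁻ x in ball x₀ ρ, ENNReal.ofReal (|f x| ^ q * φ x t)) /
      ∫⁻ x in ball x₀ ρ, ENNReal.ofReal (φ x t)) ^ (1 / q)

/-- `(H^φ,∞)`-atom related to the ball `B(x₀,ρ)`. -/
def IsAtomInf {n : ℕ} (φ : En n → ℝ → ℝ) (x₀ : En n) (ρ : ℝ) (a : En n → ℝ) : Prop :=
  Function.support a ⊆ ball x₀ ρ ∧
    (∀ x, ENNReal.ofReal |a x| ≤ (chiNorm φ (ball x₀ ρ))⁻¹) ∧
    Integrable a ∧ (∫ x, a x) = 0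

/-- `(H^φ,q)`-atom related to the ball `B(x₀,ρ)`. -/
def IsAtomQ {n : ℕ} (φ : En n → ℝ → ℝ) (x₀ : En n) (ρ q : ℝ) (a : En n → ℝ) : Prop :=
  Measurable a ∧ Function.support a ⊆ ball x₀ ρ ∧
    LqPhiNorm φ x₀ ρ q a ≤ (chiNorm φ (ball x₀ ρ))⁻¹ ∧
    Integrable a ∧ (∫ x, a x) = 0

/-- The Riesz kernel truncated at radius `r`: integrability and the value of its integral. -/
theorem integrable_and_integral_truncated_kernel (n : ℕ) (hn : 1 ≤ n) (α : ℝ) (hα : 0 < α)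
    (r : ℝ) (hr : 0 < r) :
    Integrable (fun z : En n => (Set.Iio r).indicator (fun t : ℝ => t ^ (α - (n : ℝ))) ‖z‖) ∧
    ∫ z : En n, (Set.Iio r).indicator (fun t : ℝ => t ^ (α - (n : ℝ))) ‖z‖ =
      n * volume.real (ball (0 : En n) 1) * (r ^ α / α) := by
  have : Nonempty (Fin n) := ⟨⟨0, hn⟩⟩
  have hpow : ∀ t ∈ Set.Ioi (0 : ℝ),
      t ^ (n - 1) • (Set.Iio r).indicator (fun t : ℝ => t ^ (α - (n : ℝ))) t =
        (Set.Iio r).indicator (fun t : ℝ => t ^ (α - 1)) t := by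
    intro t ht
    by_cases h : t ∈ Set.Iio r
    · rw [Set.indicator_of_mem h, Set.indicator_of_mem h, smul_eq_mul, ← Real.rpow_natCast,
        ← Real.rpow_add ht, Nat.cast_sub hn]
      congr 1
      push_cast
      ring
    · simp [Set.indicator_of_notMem h]
  have hint : IntegrableOn (fun t : ℝ => t ^ (α - 1)) (Set.Ioo 0 r) :=
    (intervalIntegral.integrableOn_Ioo_rpow_iff hr).2 (by linarith)
  constructor
  · rw [integrable_fun_norm_addHaar volume
      (f := (Set.Iio r).indicator (fun t : ℝ => t ^ (α - (n : ℝ)))), finrank_euclideanSpace_fin,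
      integrableOn_congr_fun hpow measurableSet_Ioi, integrableOn_indicator_iff measurableSet_Iio,
      Set.Iio_inter_Ioi]
    exact hint
  · rw [integral_fun_norm_addHaar volume
      ((Set.Iio r).indicator (fun t : ℝ => t ^ (α - (n : ℝ)))), finrank_euclideanSpace_fin,
      setIntegral_congr_fun measurableSet_Ioi hpow, setIntegral_indicator measurableSet_Iio,
      Set.Ioi_inter_Iio, ← integral_Ioc_eq_integral_Ioo,
      ← intervalIntegral.integral_of_le hr.le, integral_rpow (Or.inl (by linarith))]
    simp [Real.zero_rpow hα.ne', mul_assoc]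

/-- size estimate `|I_α a(x)| ≤ C A r^α` for bounded `a` supported in `B(x₀,r)`. -/
theorem stmt1 (n : ℕ) (hn : 1 ≤ n) (α : ℝ) (hα : α ∈ Set.Ioo (0 : ℝ) (n : ℝ)) :
    ∃ C > 0, ∀ (A r : ℝ) (x₀ : En n) (a : En n → ℝ), 0 < A → 0 < r →
      Measurable a → Function.support a ⊆ ball x₀ r →
      (∀ᵐ y ∂(volume : Measure (En n)), |a y| ≤ A) →
      ∀ x : En n, |rieszPot α a x| ≤ C * A * r ^ α := by
  obtain ⟨hα0, hαn⟩ := hα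
  have : Nonempty (Fin n) := ⟨⟨0, hn⟩⟩
  set V : ℝ := volume.real (ball (0 : En n) 1) with hV
  have hVpos : 0 < V :=
    ENNReal.toReal_pos (measure_ball_pos _ _ one_pos).ne' measure_ball_lt_top.ne
  refine ⟨n * V / α + V, by positivity, ?_⟩
  intro A r x₀ a hA hr _ hsupp hbound x
  obtain ⟨hki, hkv⟩ := integrable_and_integral_truncated_kernel n hn α hα0 r hr
  set k : En n → ℝ :=
    fun z => (Set.Iio r).indicator (fun t : ℝ => t ^ (α - (n : ℝ))) ‖z‖ with hk
  set c : ℝ := r ^ (α - (n : ℝ)) with hc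
  have hc0 : 0 < c := Real.rpow_pos_of_pos hr _
  have hi1 : Integrable (fun y => k (x - y)) := hki.comp_sub_left x
  have hi2 : Integrable ((ball x₀ r).indicator fun _ : En n => c) :=
    (integrable_indicator_iff measurableSet_ball).2
      (integrableOn_const measure_ball_lt_top.ne)
  have hk0 : ∀ z, 0 ≤ k z := fun z =>
    Set.indicator_apply_nonneg fun _ => Real.rpow_nonneg (norm_nonneg z) _
  have hle : ∀ᵐ y, ‖a y * ‖x - y‖ ^ (α - (n : ℝ))‖ ≤
      A * (k (x - y) + (ball x₀ r).indicator (fun _ => c) y) := by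
    filter_upwards [hbound] with y hy
    by_cases hmem : y ∈ ball x₀ r
    · rw [Set.indicator_of_mem hmem, norm_mul, Real.norm_eq_abs,
        Real.norm_of_nonneg (Real.rpow_nonneg (norm_nonneg _) _)]
      refine mul_le_mul hy ?_ (Real.rpow_nonneg (norm_nonneg _) _) hA.le
      by_cases h : ‖x - y‖ < r
      · have : k (x - y) = ‖x - y‖ ^ (α - (n : ℝ)) := Set.indicator_of_mem (s := Set.Iio r) h _
        linarith
      · have := Real.rpow_le_rpow_of_nonpos hr (not_lt.1 h) (sub_nonpos.2 hαn.le)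
        linarith [hk0 (x - y)]
    · have : a y = 0 := by
        by_contra h
        exact hmem (hsupp h)
      rw [Set.indicator_of_notMem hmem, this, zero_mul, norm_zero, add_zero]
      exact mul_nonneg hA.le (hk0 _)
  have hball : volume.real (ball x₀ r) = r ^ n * V := by
    rw [Measure.real, Measure.addHaar_ball _ _ hr.le, finrank_euclideanSpace_fin,
      ENNReal.toReal_mul, ENNReal.toReal_ofReal (by positivity), hV, Measure.real]
  have hcr : r ^ n * c = r ^ α := by
    rw [hc, ← Real.rpow_natCast, ← Real.rpow_add hr]
    congr 1
    ring
  calc |rieszPot α a x| ≤ ∫ y, A * (k (x - y) + (ball x₀ r).indicator (fun _ => c) y) :=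
        norm_integral_le_of_norm_le ((hi1.add hi2).const_mul A) hle
    _ = A * (n * V * (r ^ α / α) + r ^ n * V * c) := by
        rw [integral_const_mul, integral_add hi1 hi2, integral_sub_left_eq_self k volume x, hkv,
          integral_indicator measurableSet_ball, setIntegral_const, hball, smul_eq_mul]
    _ = (n * V / α + V) * A * r ^ α := by
        rw [← hcr]
        field_simp
end
end

section
/- Let n ≥ 1 and α ∈ (0,1). Let a : ℝ^n → ℝ be measurable with supp a ⊆ B(x₀,r), |a(y)| ≤ A for a.e. y, and ∫_{ℝ^n} a(y) dy = 0. Then there exists C = C(n,α) > 0 such that for every x ∈ ℝ^n with |x−x₀| ≥ 2r, one has |I_α a(x)| ≤ C · A · r^{n+1} · |x−x₀|^{α−n−1}. -/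
open MeasureTheory Metric Filter
open scoped ENNReal NNReal Topology

noncomputable section

/-- On `[t / 2, ∞)` the derivative of `u ↦ u ^ β`, `β ≤ 1`, is largest at `t / 2`. -/
theorem abs_rpow_sub_rpow_le {β s t : ℝ} (hβ : β ≤ 1) (ht : 0 < t) (hs : t / 2 ≤ s) :
    |s ^ β - t ^ β| ≤ |β| * (t / 2) ^ (β - 1) * |s - t| := by
  have hpos : ∀ u ∈ Set.Ici (t / 2), 0 < u := fun u hu =>
    (half_pos ht).trans_le hu
  refine (convex_Ici (t / 2)).norm_image_sub_le_of_norm_hasDerivWithin_le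
    (f := fun u : ℝ => u ^ β) (f' := fun u => β * u ^ (β - 1))
    (fun u hu => (Real.hasDerivAt_rpow_const (Or.inl (hpos u hu).ne')).hasDerivWithinAt)
    (fun u hu => ?_) (Set.mem_Ici.2 (half_le_self ht.le)) (Set.mem_Ici.2 hs)
  rw [Real.norm_eq_abs, abs_mul, abs_of_pos (Real.rpow_pos_of_pos (hpos u hu) _)]
  exact mul_le_mul_of_nonneg_left
    (Real.rpow_le_rpow_of_nonpos (half_pos ht) hu (by linarith)) (abs_nonneg _)

/-- Smoothness of the Riesz kernel away from its singularity. -/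
theorem abs_riesz_kernel_sub_le {n : ℕ} {β r : ℝ} (hβ : β ≤ 1) (hr : 0 < r) {x x₀ y : En n}
    (hx : 2 * r ≤ ‖x - x₀‖) (hy : y ∈ ball x₀ r) :
    |‖x - y‖ ^ β - ‖x - x₀‖ ^ β| ≤ |β| * (‖x - x₀‖ / 2) ^ (β - 1) * r := by
  have hdist : |‖x - y‖ - ‖x - x₀‖| ≤ r := by
    refine (abs_norm_sub_norm_le _ _).trans ?_
    rw [sub_sub_sub_cancel_left, norm_sub_rev]
    exact (mem_ball_iff_norm.1 hy).le
  refine (abs_rpow_sub_rpow_le hβ (by linarith) (by linarith [abs_le.1 hdist])).trans ?_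
  gcongr

/-- decay estimate for the Riesz potential of a bounded, compactly supported
function with vanishing integral. -/
theorem stmt2 (n : ℕ) (hn : 1 ≤ n) (α : ℝ) (hα : α ∈ Set.Ioo (0 : ℝ) 1) :
    ∃ C > 0, ∀ (A r : ℝ) (x₀ : En n) (a : En n → ℝ), 0 ≤ A → 0 < r →
      Measurable a → Function.support a ⊆ ball x₀ r →
      (∀ᵐ y ∂(volume : Measure (En n)), |a y| ≤ A) →
      Integrable a → (∫ y, a y) = 0 →
      ∀ x : En n, 2 * r ≤ ‖x - x₀‖ →
        |rieszPot α a x| ≤ C * A * r ^ ((n : ℝ) + 1) * ‖x - x₀‖ ^ (α - (n : ℝ) - 1) := by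
  have hβ_neg : α - (n : ℝ) < 0 := by
    have : (1 : ℝ) ≤ n := by exact_mod_cast hn
    linarith [hα.2]
  have hβ : α - (n : ℝ) ≤ 1 := by linarith
  have hβ_ne : α - (n : ℝ) ≠ 0 := hβ_neg.ne
  set β : ℝ := α - (n : ℝ)
  set V : ℝ := volume.real (ball (0 : En n) 1)
  have hV : 0 < V :=
    ENNReal.toReal_pos (measure_ball_pos volume 0 one_pos).ne' measure_ball_lt_top.ne
  refine ⟨|β| * 2 ^ (1 - β) * V, by positivity, ?_⟩
  intro A r x₀ a hA hr _ hsupp hbound h_int hzero x hx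
  have ht : 0 < ‖x - x₀‖ := by linarith
  set t : ℝ := ‖x - x₀‖
  set K : ℝ := |β| * (t / 2) ^ (β - 1) * r
  have ha : ∀ y, y ∉ ball x₀ r → a y = 0 := fun y hy =>
    Function.notMem_support.1 fun h => hy (hsupp h)
  have hpt : ∀ y, ‖a y * (‖x - y‖ ^ β - t ^ β)‖ ≤ K * ‖a y‖ := by
    intro y
    by_cases hy : y ∈ ball x₀ r
    · rw [norm_mul, mul_comm]
      exact mul_le_mul_of_nonneg_right (abs_riesz_kernel_sub_le hβ hr hx hy) (norm_nonneg _)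
    · simp [ha y hy]
  have hdiff : Integrable fun y => a y * (‖x - y‖ ^ β - t ^ β) :=
    (h_int.norm.const_mul K).mono'
      (h_int.aestronglyMeasurable.mul (by fun_prop : Measurable fun y : En n =>
        ‖x - y‖ ^ β - t ^ β).aestronglyMeasurable) (ae_of_all _ hpt)
  have hcancel : rieszPot α a x = ∫ y in ball x₀ r, a y * (‖x - y‖ ^ β - t ^ β) := by
    rw [setIntegral_eq_integral_of_forall_compl_eq_zero fun y hy => by simp [ha y hy]]
    calc rieszPot α a x = ∫ y, (a y * (‖x - y‖ ^ β - t ^ β) + a y * t ^ β) := by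
          simp only [rieszPot, ← mul_add, sub_add_cancel]; rfl
      _ = _ := by
          rw [integral_add hdiff (h_int.mul_const _), integral_mul_const, hzero, zero_mul, add_zero]
  have hvol : volume.real (ball x₀ r) = r ^ (n : ℝ) * V := by
    rw [measureReal_def, Measure.addHaar_ball_of_pos volume x₀ hr, ENNReal.toReal_mul,
      ENNReal.toReal_ofReal (by positivity), finrank_euclideanSpace_fin, Real.rpow_natCast]
    rfl
  calc |rieszPot α a x| ≤ K * A * volume.real (ball x₀ r) := by
        rw [hcancel, ← Real.norm_eq_abs]
        refine norm_setIntegral_le_of_norm_le_const_ae measure_ball_lt_top ?_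
        filter_upwards [ae_restrict_of_ae hbound] with y hy
        exact (hpt y).trans (mul_le_mul_of_nonneg_left hy (by positivity))
    _ = |β| * 2 ^ (1 - β) * V * A * r ^ ((n : ℝ) + 1) * t ^ (β - 1) := by
        have h2 : (2 : ℝ) ^ (1 - β) = (2 ^ (β - 1))⁻¹ := by
          rw [← Real.rpow_neg two_pos.le, neg_sub]
        rw [hvol, Real.rpow_add_one hr.ne', h2]
        simp only [K, Real.div_rpow ht.le two_pos.le]
        ring
end
end

section
/- Let Φ : ℝ^n → ℝ be a bounded measurable function with Φ(z) = 1 whenever |z| ≤ 1. Let f ∈ L^1(ℝ^n) with supp f ⊆ closed ball B̄(x₀,r). Then for every x ∈ ℝ^n with |x−x₀| ≥ r, one has |x−x₀|^{−n} · |∫_{ℝ^n} f(y) dy| ≤ 2^n · sup_{t>0} |∫_{ℝ^n} f(y) t^{−n} Φ((x−y)/t) dy|. -/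
open MeasureTheory Metric Filter
open scoped ENNReal NNReal Topology

noncomputable section

/-- for `f` supported in `B̄(x₀,r)` and `|x−x₀| ≥ r`,
`|x−x₀|^{−n} |∫ f| ≤ 2^n M_Φ f(x)`. -/
theorem stmt5 (n : ℕ) (hn : 1 ≤ n) (Φ : En n → ℝ) (hΦm : Measurable Φ)
    (hΦbd : ∃ K, ∀ z, |Φ z| ≤ K) (hΦ1 : ∀ z : En n, ‖z‖ ≤ 1 → Φ z = 1)
    (f : En n → ℝ) (hf : Integrable f) (x₀ : En n) (r : ℝ) (hr : 0 < r)
    (hsupp : Function.support f ⊆ closedBall x₀ r)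
    (x : En n) (hx : r ≤ ‖x - x₀‖) :
    ENNReal.ofReal (‖x - x₀‖ ^ (-(n : ℝ)) * |∫ y, f y|) ≤
      (2 : ℝ≥0∞) ^ n * maxFn Φ f x := by
  have hd : 0 < ‖x - x₀‖ := hr.trans_le hx
  set d := ‖x - x₀‖
  have ht : 0 < 2 * d := by positivity
  have key : ∀ y, f y * (2 * d) ^ (-(n : ℝ)) * Φ ((2 * d)⁻¹ • (x - y)) =
      (2 * d) ^ (-(n : ℝ)) * f y := by
    intro y
    by_cases hy : f y = 0
    · simp [hy]
    · have hy' : ‖y - x₀‖ ≤ r := mem_closedBall_iff_norm.1 (hsupp hy)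
      have hxy : ‖x - y‖ ≤ 2 * d := by
        have := norm_sub_le_norm_sub_add_norm_sub x x₀ y
        rw [norm_sub_rev x₀ y] at this
        linarith
      rw [hΦ1, mul_one, mul_comm]
      rw [norm_smul, norm_inv, Real.norm_of_nonneg ht.le, inv_mul_le_iff₀ ht, mul_one]
      exact hxy
  have hle : ENNReal.ofReal |(2 * d) ^ (-(n : ℝ)) * ∫ y, f y| ≤ maxFn Φ f x := by
    rw [← integral_const_mul, ← integral_congr_ae (Eventually.of_forall key)]
    exact le_iSup₂_of_le (2 * d) ht le_rfl
  refine le_trans (le_of_eq ?_) (mul_le_mul_right hle _)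
  have h2 : (2 : ℝ≥0∞) ^ n = ENNReal.ofReal (2 ^ n) := by
    rw [ENNReal.ofReal_pow zero_le_two, ENNReal.ofReal_ofNat]
  rw [h2, ← ENNReal.ofReal_mul (by positivity), abs_mul,
    abs_of_nonneg (show 0 ≤ (2 * d) ^ (-(n : ℝ)) by positivity),
    Real.mul_rpow zero_le_two hd.le, Real.rpow_neg zero_le_two, Real.rpow_natCast]
  congr 1
  field_simp
end
end

section
/- Let φ₁ be a Musielak–Orlicz function with 0 < ‖χ_B‖_{L^{φ₁}(ℝ^n)} < ∞ for every ball B. Let b be locally integrable on ℝ^n, let B = B(x_B,r_B) be a ball, set f := sign(b−b_B) (equal to 1, −1, 0 according to the sign of b(x)−b_B), and define ã := (f − f_B) χ_B / (2‖χ_B‖_{L^{φ₁}(ℝ^n)}). Let Φ : ℝ^n → ℝ be bounded measurable with Φ(z) = 1 for |z| ≤ 1. Then: (1) ∫_B (b(x)−b_B) ã(x) dx = (1/(2‖χ_B‖_{L^{φ₁}(ℝ^n)})) ∫_B |b(x)−b_B| dx; and (2) (1/(2‖χ_B‖_{L^{φ₁}(ℝ^n)})) (∫_B |b(x)−b_B|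 dx) · ‖|·−x_B|^{−n}‖_{L^{φ₁}(B^c)} ≤ 2^n ‖M_Φ((b−b_B)ã)‖_{L^{φ₁}(B^c)}. -/
open MeasureTheory Metric Filter
open scoped ENNReal NNReal Topology

noncomputable section

/-- A pointwise bound `a * f ≤ g` on `A` passes to the Musielak--Orlicz quasinorms. -/
theorem mul_eMOnormOn_le {n : ℕ} {φ : En n → ℝ → ℝ} (hφ : IsMOFun φ) {A : Set (En n)}
    (hA : MeasurableSet A) {f g : En n → ℝ≥0∞} {a : ℝ≥0∞} (ha0 : a ≠ 0) (ha : a ≠ ⊤)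
    (h : ∀ x ∈ A, a * f x ≤ g x) :
    a * eMOnormOn φ A f ≤ eMOnormOn φ A g := by
  refine le_sInf ?_
  rintro l ⟨hl0, hl⟩
  rcases eq_or_ne l ⊤ with rfl | hlt
  · exact le_top
  rw [mul_comm, ← ENNReal.le_div_iff_mul_le (Or.inl ha0) (Or.inl ha)]
  refine sInf_le ⟨ENNReal.div_pos hl0.ne' ha, le_trans (setLIntegral_mono' hA ?_) hl⟩
  intro x hx
  by_cases hg : g x = ⊤
  · simp [hg]
  have hle := h x hx
  have haf : a * f x ≠ ⊤ := ne_top_of_le_ne_top hg hle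
  have hf : f x ≠ ⊤ := fun hf => haf (by rw [hf, ENNReal.mul_top ha0])
  rw [if_neg hf, if_neg hg]
  refine ENNReal.ofReal_le_ofReal
    (hφ.mono x (Set.mem_Ici.2 (by positivity)) (Set.mem_Ici.2 (by positivity)) ?_)
  have hreal : a.toReal * (f x).toReal ≤ (g x).toReal := by
    rw [← ENNReal.toReal_mul]
    exact ENNReal.toReal_mono hg hle
  rw [ENNReal.toReal_div, div_div_eq_mul_div, mul_comm]
  gcongr

/-- Integrating against the smooth kernel at scale `2‖x - x₀‖` bounds `maxFn` from below
for functions supported in the ball, at points outside that ball. -/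
theorem le_maxFn_of_support_subset_ball {n : ℕ} {Φ : En n → ℝ}
    (hΦ : ∀ z : En n, ‖z‖ ≤ 1 → Φ z = 1) {x₀ x : En n} {ρ : ℝ} (hρ : 0 < ρ) {g : En n → ℝ}
    (hg : Function.support g ⊆ ball x₀ ρ) (hx : x ∈ (ball x₀ ρ)ᶜ) :
    ENNReal.ofReal ((2 * ‖x - x₀‖) ^ (-(n : ℝ)) * |∫ y, g y|) ≤ maxFn Φ g x := by
  have hx' : ρ ≤ ‖x - x₀‖ := by simpa [dist_eq_norm] using hx
  have ht : 0 < 2 * ‖x - x₀‖ := by linarith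
  refine le_iSup₂_of_le _ ht (ENNReal.ofReal_le_ofReal (le_of_eq ?_))
  have key : ∀ y, g y * (2 * ‖x - x₀‖) ^ (-(n : ℝ)) * Φ ((2 * ‖x - x₀‖)⁻¹ • (x - y)) =
      (2 * ‖x - x₀‖) ^ (-(n : ℝ)) * g y := by
    intro y
    by_cases hy : g y = 0
    · simp [hy]
    have hyB : ‖y - x₀‖ < ρ := by simpa [dist_eq_norm] using hg hy
    rw [hΦ, mul_one, mul_comm]
    rw [norm_smul, Real.norm_of_nonneg (inv_nonneg.2 ht.le), inv_mul_le_one₀ ht]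
    calc ‖x - y‖ = ‖(x - x₀) - (y - x₀)‖ := by rw [sub_sub_sub_cancel_right]
      _ ≤ ‖x - x₀‖ + ‖y - x₀‖ := norm_sub_le _ _
      _ ≤ 2 * ‖x - x₀‖ := by linarith
  simp_rw [key]
  rw [integral_const_mul, abs_mul, abs_of_pos (Real.rpow_pos_of_pos ht _)]

theorem sign_mul_eq_abs (r : ℝ) : Real.sign r * r = |r| := by
  rcases lt_trichotomy r 0 with h | rfl | h
  · rw [Real.sign_of_neg h, abs_of_neg h, neg_one_mul]
  · simp
  · rw [Real.sign_of_pos h, abs_of_pos h, one_mul]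

/-- The pairing of `b - b_B` with `(sign (b - b_B) - m) / d` does not depend on `m`. -/
theorem setIntegral_sub_ballAvg_mul_sign {n : ℕ} {b : En n → ℝ} (hb : LocallyIntegrable b)
    (x₀ : En n) (ρ m d : ℝ) :
    (∫ x in ball x₀ ρ, (b x - ballAvg b x₀ ρ) *
      ((Real.sign (b x - ballAvg b x₀ ρ) - m) / d)) =
      d⁻¹ * ∫ x in ball x₀ ρ, |b x - ballAvg b x₀ ρ| := by
  have hfin : volume (ball x₀ ρ) ≠ ⊤ := measure_ball_lt_top.ne
  have hbB : IntegrableOn b (ball x₀ ρ) :=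
    (hb.integrableOn_isCompact (isCompact_closedBall x₀ ρ)).mono_set ball_subset_closedBall
  have hint : IntegrableOn (fun x => b x - ballAvg b x₀ ρ) (ball x₀ ρ) :=
    hbB.sub (integrableOn_const hfin)
  have hzero : ∫ x in ball x₀ ρ, (b x - ballAvg b x₀ ρ) = 0 := by
    have : IsFiniteMeasure (volume.restrict (ball x₀ ρ)) :=
      isFiniteMeasure_restrict.2 hfin
    exact integral_sub_average _ b
  have key : ∀ x, (b x - ballAvg b x₀ ρ) *
      ((Real.sign (b x - ballAvg b x₀ ρ) - m) / d) =
      d⁻¹ * (|b x - ballAvg b x₀ ρ| - m * (b x - ballAvg b x₀ ρ)) := by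
    intro x
    rw [← sign_mul_eq_abs]
    ring
  simp_rw [key]
  rw [integral_const_mul, integral_sub hint.abs (hint.const_mul m), integral_const_mul, hzero,
    mul_zero, sub_zero]

/-- key estimate in the necessity part, using the atom
`ã = (sign(b−b_B) − (sign(b−b_B))_B) χ_B / (2‖χ_B‖_{L^{φ₁}})`. -/
theorem stmt14 (n : ℕ) (hn : 1 ≤ n) (φ₁ : En n → ℝ → ℝ) (hφ₁ : IsMOFun φ₁)
    (hχ₁ : ∀ (y₀ : En n) (ρ' : ℝ), 0 < ρ' →
      0 < chiNorm φ₁ (ball y₀ ρ') ∧ chiNorm φ₁ (ball y₀ ρ') < ⊤)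
    (b : En n → ℝ) (hb : LocallyIntegrable b)
    (x₀ : En n) (ρ : ℝ) (hρ : 0 < ρ)
    (Φ : En n → ℝ) (hΦm : Measurable Φ) (hΦbd : ∃ K, ∀ z, |Φ z| ≤ K)
    (hΦ1 : ∀ z : En n, ‖z‖ ≤ 1 → Φ z = 1) :
    ∀ (bB c fB : ℝ) (f atil : En n → ℝ),
      bB = ballAvg b x₀ ρ →
      c = (chiNorm φ₁ (ball x₀ ρ)).toReal →
      f = (fun x => Real.sign (b x - bB)) →
      fB = (⨍ x in ball x₀ ρ, f x) →
      atil = (ball x₀ ρ).indicator (fun x => (f x - fB) / (2 * c)) →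
      ((∫ x in ball x₀ ρ, (b x - bB) * atil x) =
          (2 * c)⁻¹ * ∫ x in ball x₀ ρ, |b x - bB|) ∧
        ENNReal.ofReal ((2 * c)⁻¹ * ∫ x in ball x₀ ρ, |b x - bB|) * kerNorm φ₁ x₀ ρ ≤
          (2 : ℝ≥0∞) ^ n *
            eMOnormOn φ₁ (ball x₀ ρ)ᶜ (maxFn Φ fun x => (b x - bB) * atil x) := by
  intro bB c fB f atil hbB hc hf hfB hatil
  have h1 : (∫ x in ball x₀ ρ, (b x - bB) * atil x) =
      (2 * c)⁻¹ * ∫ x in ball x₀ ρ, |b x - bB| := by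
    rw [hbB, ← setIntegral_sub_ballAvg_mul_sign hb x₀ ρ fB (2 * c)]
    refine setIntegral_congr_fun measurableSet_ball fun x hx => ?_
    simp only [hatil, Set.indicator_of_mem hx, hf, hbB]
  refine ⟨h1, ?_⟩
  set J : ℝ := (2 * c)⁻¹ * ∫ x in ball x₀ ρ, |b x - bB| with hJ
  have hsupp : Function.support (fun x => (b x - bB) * atil x) ⊆ ball x₀ ρ := by
    refine (Function.support_mul_subset_right _ _).trans ?_
    rw [hatil]
    exact Set.support_indicator_subset
  have hgint : ∫ x, (b x - bB) * atil x = J := by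
    rw [← h1, setIntegral_eq_integral_of_forall_compl_eq_zero]
    intro x hx
    exact Function.notMem_support.1 fun h => hx (hsupp h)
  rcases le_or_gt J 0 with hJ0 | hJ0
  · simp [ENNReal.ofReal_of_nonpos hJ0]
  have hpow : (2 : ℝ≥0∞) ^ n = ENNReal.ofReal (2 ^ n) := by
    rw [ENNReal.ofReal_pow zero_le_two, ENNReal.ofReal_ofNat]
  have hsplit : ENNReal.ofReal J = 2 ^ n * ENNReal.ofReal (J / 2 ^ n) := by
    rw [hpow, ← ENNReal.ofReal_mul (by positivity), mul_div_cancel₀ _ (by positivity)]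
  rw [hsplit, mul_assoc]
  gcongr
  refine mul_eMOnormOn_le hφ₁ measurableSet_ball.compl
    (ENNReal.ofReal_pos.2 (by positivity)).ne' ENNReal.ofReal_ne_top fun x hx => ?_
  refine le_trans (le_of_eq ?_) (le_maxFn_of_support_subset_ball hΦ1 hρ hsupp hx)
  rw [hgint, abs_of_pos hJ0, ← ENNReal.ofReal_mul (by positivity), abs_of_nonneg (by positivity),
    Real.mul_rpow zero_le_two (norm_nonneg _), Real.rpow_neg zero_le_two, Real.rpow_natCast]
  congr 1
  ring
end
end
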